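/- Let lambda : V' -> ZMod d be an additive group homomorphism and let phi lie in Sp(V', omega'). Then there exists gamma in PCl' (a group automorphism of P' fixing the center of P' pointwise) such that gamma(Delta_v) = zeta^((lambda v).val) * Delta_(phi v) for all v in V'. -/

import Mathlib

noncomputable section

namespace PaperPCl

/-- `d' = 2d` if `d` is even, `d' = d` if `d` is odd. -/
def dp (d : ℕ) : ℕ := if Even d then 2 * d else d

lemma d_dvd_dp (d : ℕ) : d ∣ dp d := by
  unfold dp; split
  · exact dvd_mul_left d 2
  · rfl

/-- The phase space `V = (ZMod d)^n × (ZMod d)^n`, vectors written `(q, p)`. -/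
abbrev V (d n : ℕ) := (Fin n → ZMod d) × (Fin n → ZMod d)

/-- Dot product of two vectors in `(ZMod d)^n`. -/
def dotp {d n : ℕ} (p q : Fin n → ZMod d) : ZMod d := ∑ i, p i * q i

/-- The standard symplectic form `omega((q1,p1),(q2,p2)) = p1·q2 - p2·q1`. -/
def omegaF {d n : ℕ} (v w : V d n) : ZMod d := dotp v.2 w.1 - dotp w.2 v.1

/-- Componentwise reduction mod `d`, `V' → V`. -/
def reduceV (d n : ℕ) (v : V (dp d) n) : V d n :=
  (fun i => ZMod.castHom (d_dvd_dp d) (ZMod d) (v.1 i),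
   fun i => ZMod.castHom (d_dvd_dp d) (ZMod d) (v.2 i))

/-- Componentwise `val`-lift `V → V'`. -/
def liftV (d n : ℕ) (u : V d n) : V (dp d) n :=
  (fun i => ((u.1 i).val : ZMod (dp d)), fun i => ((u.2 i).val : ZMod (dp d)))

/-- `zeta = exp(2 pi i / d)`. -/
def zeta (d : ℕ) : ℂ := Complex.exp (2 * Real.pi * Complex.I / d)

/-- `tau = exp(pi i / d)` if `d` is even, `tau = zeta^((d+1)/2)` if `d` is odd. -/
def tau (d : ℕ) : ℂ :=
  if Even d then Complex.exp (Real.pi * Complex.I / d) else zeta d ^ ((d + 1) / 2)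

/-- The Pauli matrix `D_(q,p) = X^q Z^p`, a `d^n × d^n` complex matrix. -/
def Dop (d n : ℕ) [NeZero d] (u : V d n) : Matrix (Fin n → ZMod d) (Fin n → ZMod d) ℂ :=
  fun r s => if r = s + u.1 then zeta d ^ (dotp u.2 s).val else 0

/-- The displacement operator `Delta_v = tau^(q·p) D_(vbar)` for `v = (q,p) ∈ V'`. -/
def Delta (d n : ℕ) [NeZero d] (v : V (dp d) n) : Matrix (Fin n → ZMod d) (Fin n → ZMod d) ℂ :=
  tau d ^ (dotp v.1 v.2).val • Dop d n (reduceV d n v)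

/-- The large Pauli group `P'`: the subgroup of invertible `d^n × d^n` complex matrices
generated by the scalar matrix `tau • 1` together with all `D_u`, `u ∈ V`. -/
def Pgrp (d n : ℕ) [NeZero d] : Subgroup (Matrix (Fin n → ZMod d) (Fin n → ZMod d) ℂ)ˣ :=
  Subgroup.closure {x | (x : Matrix (Fin n → ZMod d) (Fin n → ZMod d) ℂ)
      = tau d • (1 : Matrix (Fin n → ZMod d) (Fin n → ZMod d) ℂ)
    ∨ ∃ u : V d n, (x : Matrix (Fin n → ZMod d) (Fin n → ZMod d) ℂ) = Dop d n u}

/-- The underlying matrix of an element of `P'`. -/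
def matVal {d n : ℕ} [NeZero d] (g : ↥(Pgrp d n)) : Matrix (Fin n → ZMod d) (Fin n → ZMod d) ℂ :=
  ((g : (Matrix (Fin n → ZMod d) (Fin n → ZMod d) ℂ)ˣ) : Matrix (Fin n → ZMod d) (Fin n → ZMod d) ℂ)

/-- A function `γ : P' → P'` is center-respecting if `γ(z*g) = z*γ(g)`
for every `z` in the center of `P'`. -/
def CenterResp {d n : ℕ} [NeZero d] (γ : ↥(Pgrp d n) → ↥(Pgrp d n)) : Prop :=
  ∀ z ∈ Subgroup.center ↥(Pgrp d n), ∀ g, γ (z * g) = z * γ g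

/-- A group automorphism of `P'` is projective Clifford if it fixes the center pointwise. -/
def IsPCl {d n : ℕ} [NeZero d] (γ : ↥(Pgrp d n) ≃* ↥(Pgrp d n)) : Prop :=
  ∀ z ∈ Subgroup.center ↥(Pgrp d n), γ z = z

/-- A linear automorphism is symplectic if it preserves the standard symplectic form. -/
def IsSymp (d n : ℕ) (ψ : V d n ≃ₗ[ZMod d] V d n) : Prop :=
  ∀ u v : V d n, omegaF (ψ u) (ψ v) = omegaF u v

/-- `b` is a standard basis vector of `V`. -/
def IsStdBasis {d n : ℕ} (b : V d n) : Prop :=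
  (∃ i : Fin n, b = (Pi.single i 1, 0)) ∨ (∃ i : Fin n, b = (0, Pi.single i 1))

instance dp_neZero (d : ℕ) [NeZero d] : NeZero (dp d) :=
  ⟨by have := NeZero.ne d; unfold dp; split <;> omega⟩

lemma dp_dvd_sq (d : ℕ) : dp d ∣ d * d := by
  unfold dp; split
  next h => exact mul_dvd_mul_right h.two_dvd d
  next h => exact dvd_mul_left d d

/-- The character `x ↦ tau ^ x` of `ZMod d'`. -/
def tauChar (d : ℕ) (x : ZMod (dp d)) : ℂ := tau d ^ x.val

/-- The character `x ↦ zeta ^ x` of `ZMod d`. -/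
def zetaChar (d : ℕ) (x : ZMod d) : ℂ := zeta d ^ x.val

@[simp] lemma tauChar_zero (d : ℕ) : tauChar d 0 = 1 := by simp [tauChar]

@[simp] lemma zetaChar_zero (d : ℕ) : zetaChar d 0 = 1 := by simp [zetaChar]

section Phases

variable {d : ℕ} [NeZero d]

lemma zeta_isPrimitiveRoot : IsPrimitiveRoot (zeta d) d :=
  Complex.isPrimitiveRoot_exp d (NeZero.ne d)

lemma tau_sq : tau d ^ 2 = zeta d := by
  unfold tau; split
  next h =>
    rw [← Complex.exp_nat_mul, zeta]; congr 1; push_cast; ring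
  next h =>
    obtain ⟨k, hk⟩ := Nat.not_even_iff_odd.mp h
    have h2 : (d + 1) / 2 * 2 = d + 1 := by omega
    rw [← pow_mul, h2, pow_succ, zeta_isPrimitiveRoot.pow_eq_one, one_mul]

lemma tau_pow_dp : tau d ^ dp d = 1 := by
  have hz := (zeta_isPrimitiveRoot (d := d)).pow_eq_one
  by_cases h : Even d
  · rw [dp, if_pos h, pow_mul, tau_sq, hz]
  · rw [dp, if_neg h, tau, if_neg h, pow_right_comm, hz, one_pow]

lemma pow_val_natCast {m : ℕ} [NeZero m] {t : ℂ} (ht : t ^ m = 1) (k : ℕ) :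
    t ^ (k : ZMod m).val = t ^ k := by
  rw [ZMod.val_natCast, ← pow_eq_pow_mod _ ht]

lemma pow_val_add {m : ℕ} [NeZero m] {t : ℂ} (ht : t ^ m = 1) (x y : ZMod m) :
    t ^ (x + y).val = t ^ x.val * t ^ y.val := by
  rw [ZMod.val_add, ← pow_eq_pow_mod _ ht, pow_add]

lemma tauChar_add (x y : ZMod (dp d)) : tauChar d (x + y) = tauChar d x * tauChar d y :=
  pow_val_add tau_pow_dp x y

lemma zetaChar_add (x y : ZMod d) : zetaChar d (x + y) = zetaChar d x * zetaChar d y :=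
  pow_val_add zeta_isPrimitiveRoot.pow_eq_one x y

lemma tauChar_natCast (k : ℕ) : tauChar d k = tau d ^ k :=
  pow_val_natCast tau_pow_dp k

lemma tauChar_mul_neg (x : ZMod (dp d)) : tauChar d x * tauChar d (-x) = 1 := by
  rw [← tauChar_add, add_neg_cancel, tauChar_zero]

lemma zetaChar_mul_neg (x : ZMod d) : zetaChar d x * zetaChar d (-x) = 1 := by
  rw [← zetaChar_add, add_neg_cancel, zetaChar_zero]

lemma tauChar_ne_zero (x : ZMod (dp d)) : tauChar d x ≠ 0 :=
  left_ne_zero_of_mul_eq_one (tauChar_mul_neg x)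

lemma zetaChar_inj {x y : ZMod d} (h : zetaChar d x = zetaChar d y) : x = y :=
  ZMod.val_injective d (zeta_isPrimitiveRoot.pow_inj (ZMod.val_lt x) (ZMod.val_lt y) h)

lemma castHom_eq_natCast_val (x : ZMod (dp d)) :
    ZMod.castHom (d_dvd_dp d) (ZMod d) x = (x.val : ZMod d) := by
  conv_lhs => rw [← ZMod.natCast_zmod_val x]
  exact map_natCast _ _

lemma zetaChar_castHom (x : ZMod (dp d)) :
    zetaChar d (ZMod.castHom (d_dvd_dp d) (ZMod d) x) = tauChar d x * tauChar d x := by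
  rw [castHom_eq_natCast_val, zetaChar, pow_val_natCast zeta_isPrimitiveRoot.pow_eq_one,
    ← tau_sq, tauChar, ← pow_mul, ← pow_add, two_mul]

/-- The phase `zeta ^ x` is a power of `tau`. -/
lemma exists_tauChar_eq_zetaChar (x : ZMod d) : ∃ a, zetaChar d x = tauChar d a :=
  ⟨((2 * x.val : ℕ) : ZMod (dp d)), by rw [tauChar_natCast, pow_mul, tau_sq, zetaChar]⟩

end Phases

section PhaseSpace

variable {m n : ℕ}

lemma dotp_eq_dotProduct (p q : Fin n → ZMod m) : dotp p q = p ⬝ᵥ q := rfl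

lemma dotp_add_left (p p' q : Fin n → ZMod m) : dotp (p + p') q = dotp p q + dotp p' q :=
  add_dotProduct p p' q

lemma dotp_add_right (p q q' : Fin n → ZMod m) : dotp p (q + q') = dotp p q + dotp p q' :=
  dotProduct_add p q q'

lemma dotp_comm (p q : Fin n → ZMod m) : dotp p q = dotp q p := dotProduct_comm p q

@[simp] lemma dotp_zero_left (q : Fin n → ZMod m) : dotp 0 q = 0 := zero_dotProduct q

@[simp] lemma dotp_zero_right (p : Fin n → ZMod m) : dotp p 0 = 0 := dotProduct_zero p

@[simp] lemma dotp_single (p : Fin n → ZMod m) (i : Fin n) :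
    dotp p (Pi.single i 1) = p i := by
  simp [dotp_eq_dotProduct]

lemma omegaF_self_neg (v : V m n) : omegaF v (-v) = 0 := by
  simp only [omegaF, dotp_eq_dotProduct, Prod.fst_neg, Prod.snd_neg, dotProduct_neg,
    neg_dotProduct]
  ring

lemma IsSymp.symm {φ : V m n ≃ₗ[ZMod m] V m n} (hφ : IsSymp m n φ) : IsSymp m n φ.symm :=
  fun u v => by rw [← hφ]; simp

variable {d : ℕ}

lemma reduceV_add (v w : V (dp d) n) : reduceV d n (v + w) = reduceV d n v + reduceV d n w :=
  Prod.ext (funext fun _ => map_add _ _ _) (funext fun _ => map_add _ _ _)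

lemma reduceV_sub (v w : V (dp d) n) : reduceV d n (v - w) = reduceV d n v - reduceV d n w :=
  Prod.ext (funext fun _ => map_sub _ _ _) (funext fun _ => map_sub _ _ _)

@[simp] lemma reduceV_zero : reduceV d n 0 = 0 := by
  ext <;> simp [reduceV]

lemma reduceV_natCast_smul (v : V (dp d) n) : reduceV d n ((d : ZMod (dp d)) • v) = 0 := by
  refine Prod.ext (funext fun i => ?_) (funext fun i => ?_)
  all_goals exact (map_mul _ _ _).trans (by rw [map_natCast, CharP.cast_eq_zero, zero_mul]; rfl)

lemma dotp_castHom (p q : Fin n → ZMod (dp d)) :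
    dotp (fun i => ZMod.castHom (d_dvd_dp d) (ZMod d) (p i))
      (fun i => ZMod.castHom (d_dvd_dp d) (ZMod d) (q i)) =
    ZMod.castHom (d_dvd_dp d) (ZMod d) (dotp p q) := by
  simp only [dotp, map_sum, map_mul]

variable [NeZero d]

lemma reduceV_liftV (u : V d n) : reduceV d n (liftV d n u) = u := by
  ext <;> simp [reduceV, liftV]

lemma exists_eq_natCast_mul {x : ZMod (dp d)}
    (hx : ZMod.castHom (d_dvd_dp d) (ZMod d) x = 0) : ∃ y, x = (d : ZMod (dp d)) * y := by
  rw [castHom_eq_natCast_val, ZMod.natCast_eq_zero_iff] at hx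
  obtain ⟨k, hk⟩ := hx
  exact ⟨k, by rw [← Nat.cast_mul, ← hk, ZMod.natCast_zmod_val]⟩

lemma exists_eq_natCast_smul {v : V (dp d) n} (hv : reduceV d n v = 0) :
    ∃ w, v = (d : ZMod (dp d)) • w := by
  have h1 i : ∃ y, v.1 i = (d : ZMod (dp d)) * y :=
    exists_eq_natCast_mul (congrFun (congrArg Prod.fst hv) i)
  have h2 i : ∃ y, v.2 i = (d : ZMod (dp d)) * y :=
    exists_eq_natCast_mul (congrFun (congrArg Prod.snd hv) i)
  choose a ha using h1
  choose b hb using h2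
  exact ⟨(a, b), Prod.ext (funext ha) (funext hb)⟩

end PhaseSpace

section Operators

variable {d n : ℕ} [NeZero d]

lemma Dop_apply (u : V d n) (r s : Fin n → ZMod d) :
    Dop d n u r s = if r = s + u.1 then zetaChar d (dotp u.2 s) else 0 := rfl

lemma Delta_eq (v : V (dp d) n) :
    Delta d n v = tauChar d (dotp v.1 v.2) • Dop d n (reduceV d n v) := rfl

@[simp] lemma Dop_zero : Dop d n 0 = 1 := by
  ext r s
  simp [Dop_apply, Matrix.one_apply]

@[simp] lemma Delta_zero : Delta d n 0 = 1 := by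
  simp [Delta_eq]

lemma Dop_mul (u w : V d n) :
    Dop d n u * Dop d n w = zetaChar d (dotp u.2 w.1) • Dop d n (u + w) := by
  ext r t
  simp only [Matrix.mul_apply, Matrix.smul_apply, Dop_apply, smul_eq_mul, mul_ite, mul_zero,
    Finset.sum_ite_eq', Finset.mem_univ, if_true]
  have h : r = t + (u + w).1 ↔ r = t + w.1 + u.1 := by
    rw [Prod.fst_add, add_comm u.1, add_assoc]
  simp only [h]
  split_ifs
  · rw [Prod.snd_add, dotp_add_left, dotp_add_right, zetaChar_add, zetaChar_add]; ring
  · simp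

lemma Delta_mul (v w : V (dp d) n) :
    Delta d n v * Delta d n w = tauChar d (omegaF v w) • Delta d n (v + w) := by
  have h : zetaChar d (dotp (reduceV d n v).2 (reduceV d n w).1) =
      tauChar d (dotp v.2 w.1) * tauChar d (dotp v.2 w.1) := by
    rw [← zetaChar_castHom, ← dotp_castHom]; rfl
  rw [Delta_eq, Delta_eq, Delta_eq, Matrix.smul_mul, Matrix.mul_smul, Dop_mul, h, reduceV_add]
  simp only [smul_smul, ← tauChar_add]
  congr 2
  rw [omegaF, Prod.fst_add, Prod.snd_add, dotp_add_left, dotp_add_right, dotp_add_right,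
    dotp_comm v.2 w.1, dotp_comm w.2 v.1]
  ring

lemma Delta_mul_neg (v : V (dp d) n) : Delta d n v * Delta d n (-v) = 1 := by
  rw [Delta_mul, omegaF_self_neg, add_neg_cancel]; simp

lemma Dop_ne_zero (u : V d n) : Dop d n u ≠ 0 := fun h => by
  have h0 := congrFun (congrFun h u.1) 0
  simp [Dop_apply] at h0

lemma smul_Dop_inj {a b : ℂ} (ha : a ≠ 0) {u w : V d n}
    (h : a • Dop d n u = b • Dop d n w) : u = w := by
  have h1 : u.1 = w.1 := by
    by_contra hne
    have h0 := congrFun (congrFun h u.1) 0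
    simp [Dop_apply, hne, ha] at h0
  have key (s : Fin n → ZMod d) : a * zetaChar d (dotp u.2 s) = b * zetaChar d (dotp w.2 s) := by
    have h0 := congrFun (congrFun h (s + u.1)) s
    simpa [Dop_apply, h1] using h0
  have hab : a = b := by simpa using key 0
  refine Prod.ext h1 (funext fun i => zetaChar_inj ?_)
  have := key (Pi.single i 1)
  rw [← hab] at this
  simpa using mul_left_cancel₀ ha this

lemma isUnit_Dop (u : V d n) : IsUnit (Dop d n u) := by
  refine IsUnit.of_mul_eq_one (zetaChar d (dotp u.2 u.1) • Dop d n (-u)) ?_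
  rw [Matrix.mul_smul, Dop_mul, add_neg_cancel, Dop_zero, smul_smul]
  have : dotp u.2 (-u).1 = -dotp u.2 u.1 := dotProduct_neg _ _
  rw [this, zetaChar_mul_neg, one_smul]

/-- Vectors congruent to `0` modulo `d` have trivial displacement operators. -/
lemma Delta_natCast_smul (v : V (dp d) n) : Delta d n ((d : ZMod (dp d)) • v) = 1 := by
  have hd : (d : ZMod (dp d)) * d = 0 := by
    rw [← Nat.cast_mul, ZMod.natCast_eq_zero_iff]; exact dp_dvd_sq d
  have h : dotp ((d : ZMod (dp d)) • v).1 ((d : ZMod (dp d)) • v).2 = 0 := by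
    simp only [dotp_eq_dotProduct, Prod.smul_fst, Prod.smul_snd, smul_dotProduct,
      dotProduct_smul, smul_smul, hd, zero_smul]
  rw [Delta_eq, reduceV_natCast_smul, h]; simp

lemma Delta_add_natCast_smul (w m : V (dp d) n) :
    Delta d n (w + (d : ZMod (dp d)) • m) =
      tauChar d (-omegaF w ((d : ZMod (dp d)) • m)) • Delta d n w := by
  have h := Delta_mul w ((d : ZMod (dp d)) • m)
  rw [Delta_natCast_smul, mul_one] at h
  rw [h, smul_smul, mul_comm, tauChar_mul_neg, one_smul]

/-- The transformed phase and displacement depend only on the Pauli operator. -/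
lemma smul_Delta_wellDefined (lam : V (dp d) n →+ ZMod d)
    (φ : V (dp d) n ≃ₗ[ZMod (dp d)] V (dp d) n) (hφ : IsSymp (dp d) n φ)
    {a b : ZMod (dp d)} {v w : V (dp d) n}
    (h : tauChar d a • Delta d n v = tauChar d b • Delta d n w) :
    (tauChar d a * zetaChar d (lam v)) • Delta d n (φ v) =
      (tauChar d b * zetaChar d (lam w)) • Delta d n (φ w) := by
  have hred : reduceV d n v = reduceV d n w := by
    rw [Delta_eq, Delta_eq, smul_smul, smul_smul] at h
    exact smul_Dop_inj (mul_ne_zero (tauChar_ne_zero _) (tauChar_ne_zero _)) h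
  obtain ⟨m, hm⟩ := exists_eq_natCast_smul
    (v := v - w) (by rw [reduceV_sub, hred, sub_self])
  obtain rfl : v = w + (d : ZMod (dp d)) • m := by rw [← hm]; abel
  have hlam : lam (w + (d : ZMod (dp d)) • m) = lam w := by
    rw [map_add, Nat.cast_smul_eq_nsmul, map_nsmul, nsmul_eq_mul, CharP.cast_eq_zero]; simp
  have hphase : tauChar d a * tauChar d (-omegaF w ((d : ZMod (dp d)) • m)) = tauChar d b := by
    rw [Delta_add_natCast_smul, smul_smul, Delta_eq, smul_smul, smul_smul] at h
    exact mul_right_cancel₀ (tauChar_ne_zero _) (smul_left_injective ℂ (Dop_ne_zero _) h)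
  rw [hlam, map_add, map_smul, Delta_add_natCast_smul, ← map_smul φ, hφ, smul_smul, ← hphase]
  congr 1
  ring

end Operators

section PauliGroup

variable {d n : ℕ} [NeZero d]

@[simp] lemma matVal_mul (g h : ↥(Pgrp d n)) : matVal (g * h) = matVal g * matVal h := rfl

lemma matVal_injective : Function.Injective (matVal (d := d) (n := n)) :=
  fun _ _ h => Subtype.ext (Units.ext h)

lemma exists_matVal_eq_Dop (u : V d n) : ∃ g : ↥(Pgrp d n), matVal g = Dop d n u :=
  ⟨⟨(isUnit_Dop u).unit, Subgroup.subset_closure (Or.inr ⟨u, rfl⟩)⟩, rfl⟩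

lemma isUnit_tau_smul_one :
    IsUnit (tau d • (1 : Matrix (Fin n → ZMod d) (Fin n → ZMod d) ℂ)) := by
  refine IsUnit.of_mul_eq_one (tau d ^ (dp d - 1) • 1) ?_
  rw [smul_mul_smul_comm, one_mul, mul_pow_sub_one (NeZero.ne (dp d)), tau_pow_dp, one_smul]

lemma exists_matVal_eq_tau_smul_one :
    ∃ g : ↥(Pgrp d n), matVal g = tau d • 1 :=
  ⟨⟨isUnit_tau_smul_one.unit, Subgroup.subset_closure (Or.inl rfl)⟩, rfl⟩

lemma matVal_pow (g : ↥(Pgrp d n)) (k : ℕ) : matVal (g ^ k) = matVal g ^ k := by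
  simp [matVal]

lemma exists_matVal_eq_smul_Delta (a : ZMod (dp d)) (v : V (dp d) n) :
    ∃ g : ↥(Pgrp d n), matVal g = tauChar d a • Delta d n v := by
  obtain ⟨t, ht⟩ := exists_matVal_eq_tau_smul_one (d := d) (n := n)
  obtain ⟨g, hg⟩ := exists_matVal_eq_Dop (reduceV d n v)
  refine ⟨t ^ a.val * (t ^ (dotp v.1 v.2).val * g), ?_⟩
  rw [matVal_mul, matVal_mul, matVal_pow, matVal_pow, ht, hg, smul_pow, smul_pow, one_pow,
    one_pow, Matrix.smul_mul, Matrix.smul_mul, one_mul, one_mul]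
  rfl

lemma matVal_exists_smul_Delta (g : ↥(Pgrp d n)) :
    ∃ (a : ZMod (dp d)) (v : V (dp d) n), matVal g = tauChar d a • Delta d n v := by
  obtain ⟨x, hx⟩ := g
  change ∃ (a : ZMod (dp d)) (v : V (dp d) n),
    (x : Matrix (Fin n → ZMod d) (Fin n → ZMod d) ℂ) = tauChar d a • Delta d n v
  induction hx using Subgroup.closure_induction with
  | mem x hx =>
    rcases hx with hx | ⟨u, hu⟩
    · exact ⟨(1 : ℕ), 0, by rw [hx, tauChar_natCast, pow_one, Delta_zero]⟩
    · refine ⟨-dotp (liftV d n u).1 (liftV d n u).2, liftV d n u, ?_⟩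
      rw [hu, Delta_eq, smul_smul, mul_comm, tauChar_mul_neg, one_smul, reduceV_liftV]
  | one => exact ⟨0, 0, by simp⟩
  | mul x y _ _ hx hy =>
    obtain ⟨a, v, hx⟩ := hx
    obtain ⟨b, w, hy⟩ := hy
    refine ⟨a + b + omegaF v w, v + w, ?_⟩
    rw [Units.val_mul, hx, hy, smul_mul_smul_comm, Delta_mul, smul_smul, tauChar_add,
      tauChar_add]
  | inv x _ hx =>
    obtain ⟨a, v, hx⟩ := hx
    refine ⟨-a, -v, Units.inv_eq_of_mul_eq_one_right ?_⟩
    rw [hx, smul_mul_smul_comm, Delta_mul_neg, tauChar_mul_neg, one_smul]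

/-- A central element of the Pauli group is a scalar matrix. -/
lemma exists_matVal_eq_tauChar_smul_one {z : ↥(Pgrp d n)}
    (hz : z ∈ Subgroup.center ↥(Pgrp d n)) : ∃ a, matVal z = tauChar d a • 1 := by
  obtain ⟨a, v, hv⟩ := matVal_exists_smul_Delta z
  have hcomm (w : V d n) :
      dotp w.2 (reduceV d n v).1 = dotp (reduceV d n v).2 w.1 := by
    obtain ⟨g, hg⟩ := exists_matVal_eq_Dop w
    have h := congrArg matVal (Subgroup.mem_center_iff.mp hz g)
    rw [matVal_mul, matVal_mul, hg, hv, Delta_eq, smul_smul, Matrix.mul_smul, Matrix.smul_mul,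
      Dop_mul, Dop_mul, add_comm w, smul_smul, smul_smul] at h
    exact zetaChar_inj (mul_left_cancel₀ (mul_ne_zero (tauChar_ne_zero _) (tauChar_ne_zero _))
      (smul_left_injective ℂ (Dop_ne_zero _) h))
  have hv0 : reduceV d n v = 0 := by
    refine Prod.ext (funext fun i => ?_) (funext fun i => ?_)
    · have h := hcomm (0, Pi.single i 1)
      rw [dotp_comm] at h
      simpa using h
    · have h := hcomm (Pi.single i 1, 0)
      simpa using h.symm
  obtain ⟨m, rfl⟩ := exists_eq_natCast_smul hv0
  exact ⟨a, by rw [hv, Delta_natCast_smul]⟩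

/-- The endomorphism of the Pauli group encoded by a character and a symplectic map. -/
lemma exists_monoidHom_of_symplectic_encoding (lam : V (dp d) n →+ ZMod d)
    (φ : V (dp d) n ≃ₗ[ZMod (dp d)] V (dp d) n) (hφ : IsSymp (dp d) n φ) :
    ∃ f : ↥(Pgrp d n) →* ↥(Pgrp d n), ∀ g a v, matVal g = tauChar d a • Delta d n v →
      matVal (f g) = (tauChar d a * zetaChar d (lam v)) • Delta d n (φ v) := by
  have hex (g : ↥(Pgrp d n)) : ∃ h : ↥(Pgrp d n), ∀ a v,
      matVal g = tauChar d a • Delta d n v →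
      matVal h = (tauChar d a * zetaChar d (lam v)) • Delta d n (φ v) := by
    obtain ⟨a, v, hv⟩ := matVal_exists_smul_Delta g
    obtain ⟨c, hc⟩ := exists_tauChar_eq_zetaChar (lam v)
    obtain ⟨h, hh⟩ := exists_matVal_eq_smul_Delta (a + c) (φ v)
    refine ⟨h, fun b w hw => ?_⟩
    rw [hh, tauChar_add, ← hc]
    exact smul_Delta_wellDefined lam φ hφ (hv.symm.trans hw)
  choose f hf using hex
  refine ⟨MonoidHom.mk' f fun g h => matVal_injective ?_, hf⟩
  obtain ⟨a, v, hg⟩ := matVal_exists_smul_Delta g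
  obtain ⟨b, w, hh⟩ := matVal_exists_smul_Delta h
  have hgh : matVal (g * h) = tauChar d (a + b + omegaF v w) • Delta d n (v + w) := by
    rw [matVal_mul, hg, hh, smul_mul_smul_comm, Delta_mul, smul_smul, tauChar_add, tauChar_add]
  rw [hf _ _ _ hgh, matVal_mul, hf g a v hg, hf h b w hh, smul_mul_smul_comm, Delta_mul, hφ,
    smul_smul, map_add, map_add, zetaChar_add, tauChar_add, tauChar_add]
  congr 1
  ring

end PauliGroup

theorem exists_PCl_of_symplectic_encoding (d n : ℕ) [NeZero d] (hd : 2 ≤ d) (hn : 1 ≤ n)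
    (lam : V (dp d) n →+ ZMod d)
    (φ : V (dp d) n ≃ₗ[ZMod (dp d)] V (dp d) n) (hφ : IsSymp (dp d) n φ) :
    ∃ γ : ↥(Pgrp d n) ≃* ↥(Pgrp d n), IsPCl γ ∧
      ∀ v : V (dp d) n, ∀ g : ↥(Pgrp d n), matVal g = Delta d n v →
        matVal (γ g) = zeta d ^ (lam v).val • Delta d n (φ v) := by
  obtain ⟨f, hf⟩ := exists_monoidHom_of_symplectic_encoding lam φ hφ
  obtain ⟨f', hf'⟩ := exists_monoidHom_of_symplectic_encoding
    (-lam.comp φ.symm.toLinearMap.toAddMonoidHom) φ.symm hφ.symm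
  have hleft (g : ↥(Pgrp d n)) : f' (f g) = g := by
    obtain ⟨a, v, hg⟩ := matVal_exists_smul_Delta g
    obtain ⟨c, hc⟩ := exists_tauChar_eq_zetaChar (lam v)
    have h := hf g a v hg
    rw [hc, ← tauChar_add] at h
    apply matVal_injective
    rw [hf' _ _ _ h, hg, tauChar_add, ← hc]
    simp [mul_assoc, zetaChar_mul_neg]
  have hright (g : ↥(Pgrp d n)) : f (f' g) = g := by
    obtain ⟨a, v, hg⟩ := matVal_exists_smul_Delta g
    obtain ⟨c, hc⟩ := exists_tauChar_eq_zetaChar (-lam (φ.symm v))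
    have h : matVal (f' g) = (tauChar d a * zetaChar d (-lam (φ.symm v))) •
      Delta d n (φ.symm v) := hf' g a v hg
    rw [hc, ← tauChar_add] at h
    apply matVal_injective
    rw [hf _ _ _ h, hg, tauChar_add, ← hc, mul_assoc, ← zetaChar_add, neg_add_cancel]
    simp
  refine ⟨MonoidHom.toMulEquiv f f' (MonoidHom.ext hleft) (MonoidHom.ext hright), ?_, ?_⟩
  · intro z hz
    obtain ⟨a, ha⟩ := exists_matVal_eq_tauChar_smul_one hz
    apply matVal_injective
    have h := hf z a 0 (by rw [ha, Delta_zero])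
    simpa [ha] using h
  · intro v g hg
    have h := hf g 0 v (by rw [hg, tauChar_zero, one_smul])
    rwa [tauChar_zero, one_mul] at h

end PaperPCl
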